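/- Let k ≥ 2 and let α ∈ ℝ^{k−1} satisfy ω^×(α) < (k−1)/(k−2) (for k = 2 this condition reads ω^×(α) < ∞). There exists ε_0 > 0, depending only on k and α, such that for every ε ∈ (0, ε_0], setting τ = √ε, there exist C > 0 and N_0 ∈ ℕ with the following property: for every integer N ≥ N_0 and all δ_1, …, δ_{k−1} with N^{−τ} ≤ δ_i ≤ 2 (1 ≤ i ≤ k−1), there exist positive integers A_1, …, A_k, N_1, …, N_k such that the generalised arithmetic progression P' = P(0; A_1, …, A_k; N_1, …, N_k) contains the homogeneous Bohr set B_α^0(N; δ) and satisfies |P'| ≤ C δ_1 ⋯ δ_{k−1} N. -/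

import Mathlib

open scoped BigOperators
open Filter MeasureTheory

/-- Distance from `x` to the nearest integer. -/
noncomputable def dn (x : ℝ) : ℝ := |x - round x|

/-- Multiplicative exponent `ω^×(α)`: the supremum of the set of real numbers `w` such
that `‖nα₁‖⋯‖nα_d‖ < n^{-w}` holds for infinitely many `n ∈ ℕ`. -/
noncomputable def multExp {d : ℕ} (α : Fin d → ℝ) : EReal :=
  sSup {w : EReal | ∃ v : ℝ, w = (v : ℝ) ∧
    {n : ℕ | 0 < n ∧ ∏ i, dn (n * α i) < (n : ℝ) ^ (-v)}.Infinite}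

/-- The bound `(k-1)/(k-2)`, read as `∞` when `k = 2`. -/
noncomputable def mBound (k : ℕ) : EReal :=
  if k = 2 then ⊤ else ((((k : ℝ) - 1) / ((k : ℝ) - 2) : ℝ) : EReal)

/-- The Bohr set `B_α^γ(N; δ) = {n ∈ ℤ : |n| ≤ N, ‖nα_i - γ_i‖ ≤ δ_i for all i}`. -/
def BohrSet {d : ℕ} (α γ : Fin d → ℝ) (N : ℕ) (δ : Fin d → ℝ) : Set ℤ :=
  {n : ℤ | |n| ≤ (N : ℤ) ∧ ∀ i, dn ((n : ℝ) * α i - γ i) ≤ δ i}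

/-- The symmetric generalised arithmetic progression
`P(0; A₁,…,A_k; N₁,…,N_k) = {A₁n₁ + ⋯ + A_k n_k : n_i ∈ ℤ, |n_i| ≤ N_i}`. -/
def GAPsym {k : ℕ} (A Nl : Fin k → ℕ) : Set ℤ :=
  {m : ℤ | ∃ n : Fin k → ℤ, (∀ i, |n i| ≤ (Nl i : ℤ)) ∧ m = ∑ i, (A i : ℤ) * n i}


section Reduction

variable {L : Type} [AddCommGroup L]

/-- The form induced by `B` on the orthogonal complement of `v`. -/
noncomputable def schurForm (B : L →ₗ[ℤ] L →ₗ[ℤ] ℝ) (v : L) : L →ₗ[ℤ] L →ₗ[ℤ] ℝ :=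
  LinearMap.mk₂ ℤ (fun x y => B x y - B x v * B v y / B v v)
    (by intro x x' y; simp only [map_add, LinearMap.add_apply]; ring)
    (by intro c x y; simp only [map_zsmul, LinearMap.smul_apply, zsmul_eq_mul]; ring)
    (by intro x y y'; simp only [map_add]; ring)
    (by intro c x y; simp only [map_zsmul, zsmul_eq_mul]; ring)

theorem schurForm_apply (B : L →ₗ[ℤ] L →ₗ[ℤ] ℝ) (v x y : L) :
    schurForm B v x y = B x y - B x v * B v y / B v v := rfl

theorem schurForm_add_smul (B : L →ₗ[ℤ] L →ₗ[ℤ] ℝ) {v : L} (hv : B v v ≠ 0)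
    (x y : L) (c e : ℤ) : schurForm B v (x + c • v) (y + e • v) = schurForm B v x y := by
  simp only [schurForm_apply, map_add, map_zsmul, LinearMap.add_apply, LinearMap.smul_apply,
    zsmul_eq_mul]
  field_simp
  ring

theorem schurForm_self_le {B : L →ₗ[ℤ] L →ₗ[ℤ] ℝ} (hB : ∀ x y, B x y = B y x) {v : L}
    (hv : 0 < B v v) (x : L) : schurForm B v x x ≤ B x x := by
  rw [schurForm_apply, hB v x]
  have : 0 ≤ B x v * B x v / B v v := div_nonneg (mul_self_nonneg _) hv.le
  linarith

theorem exists_add_smul_le {B : L →ₗ[ℤ] L →ₗ[ℤ] ℝ} (hB : ∀ x y, B x y = B y x) {v : L}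
    (hv : 0 < B v v) (x : L) :
    ∃ c : ℤ, B (x + c • v) (x + c • v) ≤ schurForm B v x x + B v v / 4 := by
  refine ⟨-round (B x v / B v v), ?_⟩
  have h := abs_sub_round (B x v / B v v)
  set t := B x v / B v v with ht
  have hxv : B x v = t * B v v := by rw [ht]; field_simp
  have h2 : (t - round t) ^ 2 ≤ 1 / 4 := by
    rw [← sq_abs]; nlinarith [abs_nonneg (t - round t)]
  have e : B (x + (-round t) • v) (x + (-round t) • v)
      = schurForm B v x x + B v v * (t - round t) ^ 2 := by
    simp only [schurForm_apply, map_add, map_zsmul, LinearMap.add_apply, LinearMap.smul_apply,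
      zsmul_eq_mul, hB v x, hxv]
    push_cast
    field_simp
    ring
  rw [e]
  nlinarith

theorem form_pos_of_finite {B : L →ₗ[ℤ] L →ₗ[ℤ] ℝ} [Module.IsTorsionFree ℤ L]
    (hfin : ∀ R : ℝ, {x | B x x ≤ R}.Finite) {x : L} (hx : x ≠ 0) : 0 < B x x := by
  by_contra! h
  refine Set.infinite_range_of_injective (f := fun n : ℤ => n • x) ?_ ((hfin 0).subset ?_)
  · intro m n hmn
    exact smul_left_injective ℤ hx hmn
  · rintro _ ⟨n, rfl⟩
    simp only [map_zsmul, LinearMap.smul_apply, zsmul_eq_mul, Set.mem_ofPred_eq]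
    nlinarith [mul_self_nonneg (n : ℝ)]

theorem form_nonneg_of_finite {B : L →ₗ[ℤ] L →ₗ[ℤ] ℝ} [Module.IsTorsionFree ℤ L]
    (hfin : ∀ R : ℝ, {x | B x x ≤ R}.Finite) (x : L) : 0 ≤ B x x := by
  rcases eq_or_ne x 0 with rfl | hx
  · simp
  · exact (form_pos_of_finite hfin hx).le

theorem form_add_le {B : L →ₗ[ℤ] L →ₗ[ℤ] ℝ} (h0 : ∀ x, 0 ≤ B x x) (x y : L) :
    B (x + y) (x + y) ≤ 2 * B x x + 2 * B y y := by
  have := h0 (x - y)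
  simp only [map_add, map_sub, LinearMap.add_apply, LinearMap.sub_apply] at *
  linarith

theorem form_sum_le {B : L →ₗ[ℤ] L →ₗ[ℤ] ℝ} (h0 : ∀ x, 0 ≤ B x x) {ι : Type*}
    (s : Finset ι) (u : ι → L) :
    B (∑ i ∈ s, u i) (∑ i ∈ s, u i) ≤ 2 ^ s.card * ∑ i ∈ s, B (u i) (u i) := by
  classical
  induction s using Finset.induction_on with
  | empty => simp
  | insert a s ha ih =>
    rw [Finset.sum_insert ha, Finset.sum_insert ha, Finset.card_insert_of_notMem ha]
    have h1 := form_add_le h0 (u a) (∑ i ∈ s, u i)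
    have h2 : (1 : ℝ) ≤ 2 ^ s.card := one_le_pow₀ (by norm_num)
    rw [pow_succ]
    nlinarith [h0 (u a)]

/-- A form with finite sublevel sets has a primitive minimal vector. -/
theorem exists_primitive_minimal [Module.Free ℤ L] [Module.Finite ℤ L] [Nontrivial L]
    {B : L →ₗ[ℤ] L →ₗ[ℤ] ℝ} (hfin : ∀ R : ℝ, {x | B x x ≤ R}.Finite) :
    ∃ (v : L) (f : L →ₗ[ℤ] ℤ), f v = 1 ∧ ∀ x, x ≠ 0 → B v v ≤ B x x := by
  have htf : Module.IsTorsionFree ℤ L := inferInstance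
  obtain ⟨z, hz⟩ := exists_ne (0 : L)
  obtain ⟨u, ⟨hu0, -⟩, humin⟩ := Set.exists_min_image {x : L | x ≠ 0 ∧ B x x ≤ B z z}
    (fun x => B x x) ((hfin (B z z)).subset fun x hx => hx.2) ⟨z, hz, le_rfl⟩
  have hmin : ∀ x, x ≠ 0 → B u u ≤ B x x := by
    intro x hx
    by_cases h : B x x ≤ B z z
    · exact humin x ⟨hx, h⟩
    · exact (humin z ⟨hz, le_rfl⟩).trans (not_le.1 h).le
  let I : Submodule ℤ ℤ := LinearMap.range (LinearMap.applyₗ (R := ℤ) (M₂ := ℤ) u)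
  obtain ⟨g, hg⟩ := IsPrincipalIdealRing.principal I
  have hgI : g ∈ I := by rw [hg]; exact Submodule.mem_span_singleton_self g
  obtain ⟨f, hf⟩ := hgI
  change f u = g at hf
  have hdvd : ∀ h : L →ₗ[ℤ] ℤ, g ∣ h u := by
    intro h
    have : h u ∈ I := ⟨h, rfl⟩
    rw [hg] at this
    exact Ideal.mem_span_singleton.1 this
  let b := Module.Free.chooseBasis ℤ L
  choose a ha using fun i => hdvd (b.coord i)
  have huv : u = g • ∑ i, a i • b i := by
    rw [← b.sum_repr u, Finset.smul_sum]
    refine Finset.sum_congr rfl fun i _ => ?_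
    rw [smul_smul, ← ha]; rfl
  set v := ∑ i, a i • b i
  have hg0 : g ≠ 0 := by rintro rfl; exact hu0 (by simpa using huv)
  refine ⟨v, f, ?_, fun x hx => le_trans ?_ (hmin x hx)⟩
  · have : g * f v = g * 1 := by rw [← smul_eq_mul, ← map_zsmul, ← huv, hf, mul_one]
    exact mul_left_cancel₀ hg0 this
  · have h1 : B u u = (g : ℝ) ^ 2 * B v v := by
      rw [huv]
      simp only [map_zsmul, LinearMap.smul_apply, zsmul_eq_mul]
      ring
    have h2 : (1 : ℝ) ≤ (g : ℝ) ^ 2 := by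
      have : (1 : ℤ) ≤ g ^ 2 := by have := sq_pos_of_ne_zero hg0; omega
      exact_mod_cast this
    rw [h1]
    nlinarith [form_nonneg_of_finite hfin v]

/-- Schur complement formula for Gram determinants. -/
theorem det_gram_cons (B : L →ₗ[ℤ] L →ₗ[ℤ] ℝ) {v : L} (hv : B v v ≠ 0) {n : ℕ}
    (w : Fin n → L) :
    (Matrix.of fun i j => B ((Fin.cons v w : Fin (n + 1) → L) i)
      ((Fin.cons v w : Fin (n + 1) → L) j)).det
      = B v v * (Matrix.of fun i j => schurForm B v (w i) (w j)).det := by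
  let A : Matrix (Fin (n + 1)) (Fin (n + 1)) ℝ := Matrix.of fun i j =>
    B ((Fin.cons v w : Fin (n + 1) → L) i) ((Fin.cons v w : Fin (n + 1) → L) j)
  let c : Fin (n + 1) → ℝ := Fin.cons 0 fun i => B (w i) v / B v v
  let D : Matrix (Fin (n + 1)) (Fin (n + 1)) ℝ := Matrix.of fun i j => A i j - c i * A 0 j
  have hAD : A.det = D.det := by
    refine Matrix.det_eq_of_forall_row_eq_smul_add_const c 0 rfl fun i j => ?_
    simp [D, c]
  change A.det = _
  rw [hAD, Matrix.det_succ_column_zero, Fin.sum_univ_succ]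
  have h0 : ∀ i : Fin n, D i.succ 0 = 0 := by
    intro i
    simp only [D, A, c, Matrix.of_apply, Fin.cons_succ, Fin.cons_zero]
    field_simp
    ring
  have h00 : D 0 0 = B v v := by simp [D, A, c]
  simp only [h0, h00, mul_zero, zero_mul, Finset.sum_const_zero, add_zero]
  simp only [Fin.val_zero, pow_zero, one_mul]
  congr 2
  ext i j
  simp only [D, A, c, Matrix.submatrix_apply, Matrix.of_apply, Fin.succAbove_zero, Fin.cons_succ,
    Fin.cons_zero, schurForm_apply]
  ring

end Reduction

theorem exists_basis_fin_cons {L : Type} [AddCommGroup L] {f : L →ₗ[ℤ] ℤ} {v : L}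
    (hf : f v = 1) {n : ℕ} (b' : Module.Basis (Fin n) ℤ (LinearMap.ker f)) (c : Fin n → ℤ) :
    ∃ b : Module.Basis (Fin (n + 1)) ℤ L,
      (∀ i, b i = (Fin.cons v (fun i => (b' i : L) + c i • v) : Fin (n + 1) → L) i) ∧
      ∀ (x : L) (y : LinearMap.ker f), (y : L) = x - f x • v → ∀ i : Fin n, b.repr x i.succ = b'.repr y i := by
  set w : Fin (n + 1) → L := Fin.cons v (fun i => (b' i : L) + c i • v) with hw
  have hfw : ∀ i, f (b' i) = 0 := fun i => LinearMap.mem_ker.1 (b' i).2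
  have hli : LinearIndependent ℤ w := by
    rw [Fintype.linearIndependent_iff]
    intro g hg
    rw [Fin.sum_univ_succ] at hg
    simp only [hw, Fin.cons_zero, Fin.cons_succ] at hg
    have h1 := congrArg f hg
    simp only [map_add, map_sum, map_smul, hfw, hf, smul_eq_mul, mul_one, zero_add,
      map_zero] at h1
    have h2 : ∑ i, g i.succ • b' i = 0 := by
      apply Subtype.ext
      push_cast
      simp only [smul_add, Finset.sum_add_distrib, smul_smul, ← Finset.sum_smul] at hg
      rw [add_left_comm, ← add_smul, h1, zero_smul, add_zero] at hg
      exact hg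
    have h3 := Fintype.linearIndependent_iff.1 b'.linearIndependent _ h2
    refine Fin.cases ?_ h3
    simpa [h3] using h1
  have hrep : ∀ (x : L) (y : LinearMap.ker f), (y : L) = x - f x • v →
      x = ∑ i, (Fin.cons (f x - ∑ i, b'.repr y i * c i) (fun i => b'.repr y i) :
        Fin (n + 1) → ℤ) i • w i := by
    intro x y hy
    have h4 : ∑ i, b'.repr y i • (b' i : L) = x - f x • v := by
      rw [← hy]
      conv_rhs => rw [← b'.sum_repr y]
      push_cast
      rfl
    rw [Fin.sum_univ_succ]
    simp only [hw, Fin.cons_zero, Fin.cons_succ, smul_add, Finset.sum_add_distrib, smul_smul,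
      ← Finset.sum_smul, h4, sub_smul]
    abel
  have hsp : ⊤ ≤ Submodule.span ℤ (Set.range w) := by
    intro x _
    rw [hrep x ⟨x - f x • v, by simp [hf]⟩ rfl]
    exact Submodule.sum_mem _ fun i _ =>
      Submodule.smul_mem _ _ (Submodule.subset_span ⟨i, rfl⟩)
  refine ⟨Module.Basis.mk hli hsp, fun i => by simp, fun x y hy i => ?_⟩
  have h5 := hrep x y hy
  have h6 : x = ∑ i, (Fin.cons (f x - ∑ i, b'.repr y i * c i) (fun i => b'.repr y i) :
        Fin (n + 1) → ℤ) i • Module.Basis.mk hli hsp i := by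
    simpa only [Module.Basis.mk_apply] using h5
  rw [h6, Module.Basis.repr_sum_self, Fin.cons_succ]

/-- Reduction theory: every lattice has a basis whose orthogonality defect is bounded. -/
theorem exists_reduced_basis (n : ℕ) : ∃ C : ℝ, 0 < C ∧
    ∀ (L : Type) [AddCommGroup L] [Module.Free ℤ L] [Module.Finite ℤ L],
      Module.finrank ℤ L = n → ∀ B : L →ₗ[ℤ] L →ₗ[ℤ] ℝ, (∀ x y, B x y = B y x) →
      (∀ R : ℝ, {x | B x x ≤ R}.Finite) →
      ∃ b : Module.Basis (Fin n) ℤ L,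
        (Matrix.of fun i j => B (b i) (b j)).det ≤ ∏ i, B (b i) (b i) ∧
        ∏ i, B (b i) (b i) ≤ C * (Matrix.of fun i j => B (b i) (b j)).det ∧
        ∀ x i, (b.repr x i : ℝ) ^ 2 * B (b i) (b i) ≤ C * B x x := by
  induction n with
  | zero =>
    refine ⟨1, one_pos, fun L _ _ _ hL B _ _ => ⟨Module.finBasisOfFinrankEq ℤ L hL, ?_⟩⟩
    simp
  | succ n ih =>
    obtain ⟨C, hC, ih⟩ := ih
    refine ⟨(4 / 3) ^ n * C + 4 / 3 * C + (2 + 2 ^ (n + 1) * (n * (4 / 3 * C))), by positivity,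
      fun L _ _ _ hL B hB hfin => ?_⟩
    have : Nontrivial L := Module.nontrivial_of_finrank_pos (R := ℤ) (by omega)
    obtain ⟨v, f, hfv, hmin⟩ := exists_primitive_minimal hfin
    have hv0 : v ≠ 0 := by rintro rfl; simp at hfv
    have hv : 0 < B v v := form_pos_of_finite hfin hv0
    have h0 : ∀ x, 0 ≤ B x x := form_nonneg_of_finite hfin
    have hrank : Module.finrank ℤ (LinearMap.ker f) = n := by
      obtain ⟨b, -⟩ := exists_basis_fin_cons hfv (Module.finBasis ℤ (LinearMap.ker f)) 0
      have h1 := Module.finrank_eq_card_basis b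
      rw [hL, Fintype.card_fin] at h1
      omega
    choose s hs using exists_add_smul_le hB hv
    let S := schurForm B v
    obtain ⟨b', hb1, hb2, hb3⟩ := ih (LinearMap.ker f) hrank
      (S.compl₁₂ (LinearMap.ker f).subtype (LinearMap.ker f).subtype)
      (by
        intro x y
        simp only [S, LinearMap.compl₁₂_apply, schurForm_apply, Submodule.subtype_apply]
        rw [hB x y, hB x v, hB v y, mul_comm])
      (by
        intro R
        refine Set.Finite.of_finite_image (f := fun x : LinearMap.ker f => (x : L) + s x • v)
          ((hfin (R + B v v / 4)).subset ?_) ?_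
        · rintro _ ⟨x, hx, rfl⟩
          have hx' : S x x ≤ R := hx
          exact (hs x).trans (by linarith)
        · intro x _ y _ hxy
          have h1 := congrArg f hxy
          simp only [map_add, map_smul, hfv, LinearMap.mem_ker.1 x.2, LinearMap.mem_ker.1 y.2,
            smul_eq_mul, mul_one, zero_add] at h1
          simp only [h1] at hxy
          exact Subtype.ext (add_right_cancel hxy))
    simp only [LinearMap.compl₁₂_apply, Submodule.subtype_apply] at hb1 hb2 hb3
    obtain ⟨b, hb, hrepr⟩ := exists_basis_fin_cons hfv b' fun i => s (b' i)
    have hbz : b 0 = v := by simp [hb]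
    have hbs : ∀ i : Fin n, b i.succ = b' i + s (b' i) • v := fun i => by simp [hb]
    have hSb : ∀ i j : Fin n, S (b i.succ) (b j.succ) = S (b' i) (b' j) := fun i j => by
      rw [hbs, hbs]; exact schurForm_add_smul B hv.ne' _ _ _ _
    have hdet : (Matrix.of fun i j => B (b i) (b j)).det
        = B v v * (Matrix.of fun i j => S (b' i) (b' j)).det := by
      have := det_gram_cons B hv.ne' fun i => b i.succ
      have hcons : (Fin.cons v fun i => b i.succ : Fin (n + 1) → L) = b := by
        ext i; refine Fin.cases ?_ (fun i => ?_) i <;> simp [hbz]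
      rw [hcons] at this
      rw [this]
      congr 3
      ext i j
      exact hSb i j
    have hup : ∀ i : Fin n, B (b i.succ) (b i.succ) ≤ 4 / 3 * S (b' i) (b' i) := by
      intro i
      have h1 := hs (b' i)
      rw [← hbs] at h1
      have h2 := hmin _ (b.ne_zero i.succ)
      change _ ≤ S (b' i) (b' i) + _ at h1
      linarith
    have hlow : ∀ i : Fin n, S (b' i) (b' i) ≤ B (b i.succ) (b i.succ) := by
      intro i
      rw [← hSb]
      exact schurForm_self_le hB hv _
    have hSpos : ∀ i : Fin n, 0 ≤ S (b' i) (b' i) := fun i => by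
      linarith [h0 (b i.succ), hup i]
    have hprod : ∏ i, S (b' i) (b' i) ≤ ∏ i : Fin n, B (b i.succ) (b i.succ) :=
      Finset.prod_le_prod (fun i _ => hSpos i) fun i _ => hlow i
    have hprod' : ∏ i : Fin n, B (b i.succ) (b i.succ)
        ≤ (4 / 3) ^ n * ∏ i, S (b' i) (b' i) := by
      calc _ ≤ ∏ i : Fin n, (4 / 3 * S (b' i) (b' i)) :=
            Finset.prod_le_prod (fun i _ => h0 _) fun i _ => hup i
        _ = _ := by
          rw [Finset.prod_mul_distrib, Finset.prod_const, Finset.card_univ, Fintype.card_fin]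
    have hcoord : ∀ x (i : Fin n), (b.repr x i.succ : ℝ) ^ 2 * B (b i.succ) (b i.succ)
        ≤ 4 / 3 * C * B x x := by
      intro x i
      have hmem : x - f x • v ∈ LinearMap.ker f := by simp [hfv]
      rw [hrepr x ⟨_, hmem⟩ rfl i]
      have h1 := hb3 ⟨_, hmem⟩ i
      have h2 : S (x - f x • v) (x - f x • v) = S x x := by
        have := schurForm_add_smul B hv.ne' x x (-f x) (-f x)
        simpa only [neg_smul, ← sub_eq_add_neg] using this
      simp only [h2] at h1
      have h3 : S x x ≤ B x x := schurForm_self_le hB hv x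
      have h4 := mul_le_mul_of_nonneg_left (hup i)
        (sq_nonneg (b'.repr ⟨x - f x • v, hmem⟩ i : ℝ))
      have h5 := mul_le_mul_of_nonneg_left h3 hC.le
      linarith
    have hdet0 : 0 ≤ (Matrix.of fun i j => S (b' i) (b' j)).det :=
      nonneg_of_mul_nonneg_right
        ((Finset.prod_nonneg fun i _ => hSpos i).trans hb2) hC
    refine ⟨b, ?_, ?_, fun x i => ?_⟩
    · rw [hdet, Fin.prod_univ_succ, hbz]
      exact mul_le_mul_of_nonneg_left (hb1.trans hprod) hv.le
    · rw [hdet, Fin.prod_univ_succ, hbz]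
      calc _ ≤ B v v * ((4 / 3) ^ n * (C * (Matrix.of fun i j => S (b' i) (b' j)).det)) := by
            refine mul_le_mul_of_nonneg_left (hprod'.trans ?_) hv.le
            gcongr
        _ = ((4 / 3) ^ n * C) * (B v v * (Matrix.of fun i j => S (b' i) (b' j)).det) := by ring
        _ ≤ _ := by
            refine mul_le_mul_of_nonneg_right ?_ (mul_nonneg hv.le hdet0)
            have : 0 ≤ 4 / 3 * C + (2 + 2 ^ (n + 1) * (n * (4 / 3 * C))) := by positivity
            linarith
    · refine Fin.cases ?_ (fun i => ?_) i
      · set u : Fin n → L := fun i => b.repr x i.succ • b i.succ with hu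
        have hx : b.repr x 0 • b 0 = x + (-1 : ℤ) • ∑ i, u i := by
          conv_rhs => rw [← b.sum_repr x]
          rw [Fin.sum_univ_succ]
          simp [hu]
        have h1 : (b.repr x 0 : ℝ) ^ 2 * B (b 0) (b 0)
            = B (b.repr x 0 • b 0) (b.repr x 0 • b 0) := by
          simp only [map_zsmul, LinearMap.smul_apply, zsmul_eq_mul]
          ring
        have h2 := form_add_le h0 x ((-1 : ℤ) • ∑ i, u i)
        have h3 : B ((-1 : ℤ) • ∑ i, u i) ((-1 : ℤ) • ∑ i, u i) = B (∑ i, u i) (∑ i, u i) := by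
          simp only [map_zsmul, LinearMap.smul_apply, zsmul_eq_mul]
          push_cast
          ring
        have h4 := form_sum_le h0 Finset.univ u
        have h5 : ∑ i, B (u i) (u i) ≤ n * (4 / 3 * C * B x x) := by
          have : ∀ i ∈ Finset.univ, B (u i) (u i) ≤ 4 / 3 * C * B x x := by
            intro i _
            refine le_trans (le_of_eq ?_) (hcoord x i)
            simp only [hu, map_zsmul, LinearMap.smul_apply, zsmul_eq_mul]
            ring
          simpa using Finset.sum_le_card_nsmul _ _ _ this
        rw [Finset.card_univ, Fintype.card_fin] at h4
        have h6 : (2 : ℝ) ^ n * ∑ i, B (u i) (u i) ≤ 2 ^ n * (n * (4 / 3 * C * B x x)) := by gcongr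
        rw [h1, hx]
        have h7 : 0 ≤ ((4 / 3) ^ n * C + 4 / 3 * C) * B x x := mul_nonneg (by positivity) (h0 x)
        rw [h3] at h2
        have h8 : (2 : ℝ) ^ (n + 1) = 2 * 2 ^ n := by ring
        rw [h8]
        linarith
      · have h7 : 0 ≤ ((4 / 3) ^ n * C + (2 + 2 ^ (n + 1) * (n * (4 / 3 * C)))) * B x x :=
          mul_nonneg (by positivity) (h0 x)
        linarith [hcoord x i]

section MatrixForm

variable {n : ℕ}

/-- The form `(x, y) ↦ ⟨xM, yM⟩` on integer vectors. -/
noncomputable def matrixForm (M : Matrix (Fin n) (Fin n) ℝ) :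
    (Fin n → ℤ) →ₗ[ℤ] (Fin n → ℤ) →ₗ[ℤ] ℝ :=
  LinearMap.mk₂ ℤ
    (fun x y => ∑ l, (∑ i, (x i : ℝ) * M i l) * ∑ i, (y i : ℝ) * M i l)
    (by intro x x' y; simp [add_mul, Finset.sum_add_distrib])
    (by intro c x y; simp only [Pi.smul_apply, smul_eq_mul, Int.cast_mul, mul_assoc,
          ← Finset.mul_sum, zsmul_eq_mul])
    (by intro x y y'; simp [add_mul, mul_add, Finset.sum_add_distrib])
    (by intro c x y; simp only [Pi.smul_apply, smul_eq_mul, Int.cast_mul, mul_assoc,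
          ← Finset.mul_sum, zsmul_eq_mul, mul_left_comm _ (c : ℝ)])

theorem matrixForm_apply (M : Matrix (Fin n) (Fin n) ℝ) (x y : Fin n → ℤ) :
    matrixForm M x y = ∑ l, (∑ i, (x i : ℝ) * M i l) * ∑ i, (y i : ℝ) * M i l := rfl

theorem matrixForm_comm (M : Matrix (Fin n) (Fin n) ℝ) (x y : Fin n → ℤ) :
    matrixForm M x y = matrixForm M y x := by
  simp only [matrixForm_apply, mul_comm]

theorem det_gram_matrixForm (M : Matrix (Fin n) (Fin n) ℝ)
    (b : Module.Basis (Fin n) ℤ (Fin n → ℤ)) :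
    (Matrix.of fun i j => matrixForm M (b i) (b j)).det = M.det ^ 2 := by
  let U : Matrix (Fin n) (Fin n) ℤ := Matrix.of fun i j => b i j
  let P := U.map (Int.castRingHom ℝ) * M
  have hP : (Matrix.of fun i j => matrixForm M (b i) (b j)) = P * P.transpose := by
    ext i j
    simp only [P, U, matrixForm_apply, Matrix.mul_apply, Matrix.of_apply, Matrix.transpose_apply,
      Matrix.map_apply, Int.coe_castRingHom]
  have hU : U.det ^ 2 = 1 := by
    have h1 := (Pi.basisFun ℤ (Fin n)).isUnit_det b
    have h2 : (Pi.basisFun ℤ (Fin n)).toMatrix b = U.transpose := by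
      ext i j
      simp [U, Module.Basis.toMatrix_apply]
    rw [Module.Basis.det_apply, h2, Matrix.det_transpose] at h1
    rcases Int.isUnit_iff.1 h1 with h | h <;> simp [h]
  have hU' : (U.map (Int.castRingHom ℝ)).det ^ 2 = 1 := by
    have : (U.map (Int.castRingHom ℝ)).det = (U.det : ℝ) := by
      rw [← RingHom.mapMatrix_apply, ← RingHom.map_det]; rfl
    rw [this]
    exact_mod_cast hU
  rw [hP, Matrix.det_mul, Matrix.det_transpose, Matrix.det_mul]
  linear_combination M.det ^ 2 * hU'

end MatrixForm

section BohrLattice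

variable {d : ℕ}

/-- Rows generate the lattice of the points `(n / N, (n αᵢ - mᵢ) / δᵢ)`. -/
noncomputable def bohrMatrix (α : Fin d → ℝ) (N : ℕ) (δ : Fin d → ℝ) :
    Matrix (Fin (d + 1)) (Fin (d + 1)) ℝ :=
  Matrix.of (Fin.cons (Fin.cons (1 / (N : ℝ)) fun j => α j / δ j)
    fun i => Fin.cons 0 fun j => if i = j then -1 / δ j else 0)

theorem bohrMatrix_det_sq (α : Fin d → ℝ) (N : ℕ) (δ : Fin d → ℝ) :
    (bohrMatrix α N δ).det ^ 2 = (1 / ((∏ i, δ i) * N)) ^ 2 := by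
  have h : (bohrMatrix α N δ).det = 1 / (N : ℝ) * ∏ i, (-1 / δ i) := by
    rw [Matrix.det_of_isUpperTriangular, Fin.prod_univ_succ]
    · simp [bohrMatrix]
    · intro i j hij
      revert hij
      refine Fin.cases ?_ (fun i => ?_) i
      · intro hij; exact absurd hij (by simp)
      · refine Fin.cases ?_ (fun j => ?_) j
        · simp [bohrMatrix]
        · intro hij
          have : i ≠ j := by rintro rfl; simp at hij
          simp [bohrMatrix, this]
  rw [h, Finset.prod_div_distrib, Finset.prod_const, mul_pow, div_pow (_ ^ _), ← pow_mul,
    mul_comm _ 2, pow_mul]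
  norm_num
  ring

theorem bohrForm_self (α : Fin d → ℝ) (N : ℕ) (δ : Fin d → ℝ) (x : Fin (d + 1) → ℤ) :
    matrixForm (bohrMatrix α N δ) x x
      = ((x 0 : ℝ) / N) ^ 2 + ∑ j, (((x 0 : ℝ) * α j - x j.succ) / δ j) ^ 2 := by
  rw [matrixForm_apply, Fin.sum_univ_succ]
  congr 1
  · rw [Fin.sum_univ_succ]
    simp [bohrMatrix]
    ring
  · refine Finset.sum_congr rfl fun j _ => ?_
    rw [Fin.sum_univ_succ]
    simp [bohrMatrix]
    ring

theorem le_sqrt_bohrForm {α : Fin d → ℝ} {N : ℕ} {δ : Fin d → ℝ} (hN : 0 < N)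
    (hδ : ∀ i, 0 < δ i) (x : Fin (d + 1) → ℤ) {R : ℝ}
    (hR : matrixForm (bohrMatrix α N δ) x x ≤ R) :
    |(x 0 : ℝ)| ≤ √R * N ∧ ∀ j, |(x 0 : ℝ) * α j - x j.succ| ≤ √R * δ j := by
  rw [bohrForm_self] at hR
  have hN' : (0 : ℝ) < N := by exact_mod_cast hN
  have hs : ∀ j, (((x 0 : ℝ) * α j - x j.succ) / δ j) ^ 2
      ≤ ∑ j, (((x 0 : ℝ) * α j - x j.succ) / δ j) ^ 2 := fun j =>
    Finset.single_le_sum (f := fun j => (((x 0 : ℝ) * α j - x j.succ) / δ j) ^ 2)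
      (fun i _ => sq_nonneg _) (Finset.mem_univ j)
  constructor
  · have h1 : ((x 0 : ℝ) / N) ^ 2 ≤ R := by
      have := Finset.sum_nonneg (s := Finset.univ) fun j _ =>
        sq_nonneg (((x 0 : ℝ) * α j - x j.succ) / δ j)
      linarith
    have h2 := Real.abs_le_sqrt h1
    rwa [abs_div, abs_of_pos hN', div_le_iff₀ hN'] at h2
  · intro j
    have h1 : (((x 0 : ℝ) * α j - x j.succ) / δ j) ^ 2 ≤ R := by
      linarith [hs j, sq_nonneg ((x 0 : ℝ) / N)]
    have h2 := Real.abs_le_sqrt h1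
    rwa [abs_div, abs_of_pos (hδ j), div_le_iff₀ (hδ j)] at h2

theorem bohrForm_finite {α : Fin d → ℝ} {N : ℕ} {δ : Fin d → ℝ} (hN : 0 < N)
    (hδ : ∀ i, 0 < δ i) (R : ℝ) :
    {x | matrixForm (bohrMatrix α N δ) x x ≤ R}.Finite := by
  let u : Fin (d + 1) → ℤ := Fin.cons ⌈√R * N⌉ fun j => ⌈√R * N * |α j| + √R * δ j⌉
  refine (Set.finite_Icc (-u) u).subset fun x hx => ?_
  obtain ⟨h0, hj⟩ := le_sqrt_bohrForm hN hδ x hx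
  have key : ∀ i, |x i| ≤ u i := by
    refine Fin.cases ?_ fun j => ?_
    · simp only [u, Fin.cons_zero]
      have : ((|x 0| : ℤ) : ℝ) ≤ ⌈√R * N⌉ := by
        push_cast; exact h0.trans (Int.le_ceil _)
      exact_mod_cast this
    · simp only [u, Fin.cons_succ]
      have : ((|x j.succ| : ℤ) : ℝ) ≤ ⌈√R * N * |α j| + √R * δ j⌉ := by
        refine le_trans ?_ (Int.le_ceil _)
        push_cast
        have h1 : |(x j.succ : ℝ)| ≤ |(x 0 : ℝ) * α j| + |(x 0 : ℝ) * α j - x j.succ| := by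
          have := abs_sub ((x 0 : ℝ) * α j) ((x 0 : ℝ) * α j - x j.succ)
          simpa using this
        rw [abs_mul] at h1
        have h2 := mul_le_mul_of_nonneg_right h0 (abs_nonneg (α j))
        linarith [hj j]
      exact_mod_cast this
  exact ⟨fun i => (abs_le.1 (key i)).1, fun i => (abs_le.1 (key i)).2⟩

end BohrLattice

section Diophantine

variable {d : ℕ}

theorem exists_prod_dn_lower_bound {α : Fin d → ℝ} {w : ℝ} (hw : multExp α < w) :
    ∃ c : ℝ, 0 < c ∧ ∀ n : ℕ, 0 < n → c * (n : ℝ) ^ (-w) ≤ ∏ i, dn (n * α i) := by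
  have hfin : {n : ℕ | 0 < n ∧ ∏ i, dn (n * α i) < (n : ℝ) ^ (-w)}.Finite := by
    by_contra h
    exact (not_le.2 hw) (le_sSup ⟨w, rfl, h⟩)
  have hdn0 : ∀ x, 0 ≤ dn x := fun x => abs_nonneg _
  have hpos : ∀ n : ℕ, 0 < n → 0 < ∏ i, dn (n * α i) := by
    intro n hn
    refine lt_of_le_of_ne (Finset.prod_nonneg fun i _ => hdn0 _) fun h0 => ?_
    obtain ⟨i, -, hi⟩ := Finset.prod_eq_zero_iff.1 h0.symm
    refine Set.infinite_range_of_injective (f := fun m : ℕ => (m + 1) * n) ?_ (hfin.subset ?_)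
    · intro a b hab
      have := Nat.eq_of_mul_eq_mul_right hn hab
      omega
    · rintro _ ⟨m, rfl⟩
      have hmn : 0 < (m + 1) * n := by positivity
      refine ⟨hmn, ?_⟩
      rw [Finset.prod_eq_zero (Finset.mem_univ i)]
      · have : (0 : ℝ) < ((m + 1) * n : ℕ) := by exact_mod_cast hmn
        positivity
      · have h1 : (n : ℝ) * α i = round ((n : ℝ) * α i) := by
          have := abs_eq_zero.1 hi
          linarith
        have h2 : (((m + 1) * n : ℕ) : ℝ) * α i
            = (((m + 1 : ℤ) * round ((n : ℝ) * α i) : ℤ) : ℝ) := by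
          push_cast
          rw [mul_assoc, ← h1]
        rw [dn, h2, round_intCast, sub_self, abs_zero]
  have hex : ∀ S : Finset ℕ, ∃ c : ℝ, 0 < c ∧ ∀ n ∈ S, 0 < n →
      c * (n : ℝ) ^ (-w) ≤ ∏ i, dn (n * α i) := by
    intro S
    induction S using Finset.induction_on with
    | empty => exact ⟨1, one_pos, by simp⟩
    | insert a S ha ih =>
      obtain ⟨c, hc, hS⟩ := ih
      rcases Nat.eq_zero_or_pos a with rfl | ha0
      · refine ⟨c, hc, fun n hn hn0 => hS n ?_ hn0⟩
        exact (Finset.mem_insert.1 hn).resolve_left hn0.ne'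
      · have ha' : (0 : ℝ) < (a : ℝ) ^ (-w) := Real.rpow_pos_of_pos (by exact_mod_cast ha0) _
        refine ⟨min c ((∏ i, dn (a * α i)) / (a : ℝ) ^ (-w)),
          lt_min hc (div_pos (hpos a ha0) ha'), fun n hn hn0 => ?_⟩
        rcases Finset.mem_insert.1 hn with rfl | hn
        · rw [← le_div_iff₀ ha']
          exact min_le_right _ _
        · refine le_trans ?_ (hS n hn hn0)
          gcongr
          exact min_le_left _ _
  obtain ⟨c, hc, hS⟩ := hex hfin.toFinset
  refine ⟨min c 1, lt_min hc one_pos, fun n hn => ?_⟩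
  have hn' : (0 : ℝ) ≤ (n : ℝ) ^ (-w) := by positivity
  by_cases h : ∏ i, dn (n * α i) < (n : ℝ) ^ (-w)
  · refine le_trans ?_ (hS n (by simpa using ⟨hn, h⟩) hn)
    gcongr
    exact min_le_left _ _
  · refine le_trans ?_ (not_lt.1 h)
    calc _ ≤ 1 * (n : ℝ) ^ (-w) := by gcongr; exact min_le_right _ _
      _ = _ := one_mul _

theorem exists_exponent_btwn {α : Fin d → ℝ} (hd : 1 ≤ d) (h : multExp α < mBound (d + 1)) :
    ∃ w : ℝ, 0 < w ∧ multExp α < w ∧ d * w < d + w := by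
  have hb : 0 < mBound (d + 1) := by
    unfold mBound
    split_ifs with h2
    · exact EReal.zero_lt_top
    · have : (2 : ℝ) ≤ d := by exact_mod_cast (by omega : 2 ≤ d)
      refine EReal.coe_pos.2 (div_pos ?_ ?_) <;> push_cast <;> linarith
  obtain ⟨w, hw1, hw2⟩ := EReal.lt_iff_exists_real_btwn.1 (max_lt h hb)
  obtain ⟨h1, h0⟩ := max_lt_iff.1 hw1
  refine ⟨w, EReal.coe_pos.1 h0, h1, ?_⟩
  unfold mBound at hw2
  split_ifs at hw2 with h2
  · have : d = 1 := by omega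
    subst this
    norm_num
  · have : (2 : ℝ) ≤ d := by exact_mod_cast (by omega : 2 ≤ d)
    rw [EReal.coe_lt_coe_iff, lt_div_iff₀ (by push_cast; linarith)] at hw2
    push_cast at hw2
    linarith

theorem dn_natAbs_mul_le (n m : ℤ) (a : ℝ) : dn (n.natAbs * a) ≤ |(n : ℝ) * a - m| := by
  rcases Int.natAbs_eq n with h | h
  · have h' : (n : ℝ) = n.natAbs := by
      rw [← Int.cast_natCast (R := ℝ) n.natAbs, ← h]
    rw [h']
    exact round_le _ _
  · have h' : (n : ℝ) = -n.natAbs := by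
      rw [← Int.cast_natCast (R := ℝ) n.natAbs, ← Int.cast_neg, ← h]
    rw [h']
    have := round_le ((n.natAbs : ℝ) * a) (-m)
    rw [dn]
    refine this.trans (le_of_eq ?_)
    rw [← abs_neg]
    congr 1
    push_cast
    ring

/-- Lower bound for the first minimum of the lattice of a Bohr set. -/
theorem bohrForm_lower_bound {α : Fin d → ℝ} {w c : ℝ} (hw : 0 < w) (hc : 0 < c)
    (hα : ∀ n : ℕ, 0 < n → c * (n : ℝ) ^ (-w) ≤ ∏ i, dn (n * α i)) :
    ∃ c' : ℝ, 0 < c' ∧ ∀ N : ℕ, 0 < N → ∀ δ : Fin d → ℝ, (∀ i, 0 < δ i) → (∀ i, δ i ≤ 2) →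
      ∀ x, x ≠ 0 → (c' * (N : ℝ) ^ (-(w / (d + w)))) ^ 2 ≤ matrixForm (bohrMatrix α N δ) x x := by
  have hdw : 0 < d + w := by positivity
  refine ⟨min (1 / 2) ((c / 2 ^ d) ^ (1 / (d + w))), by positivity, ?_⟩
  intro N hN δ hδ hδ2 x hx
  have hN' : (0 : ℝ) < N := by exact_mod_cast hN
  have hN1 : (1 : ℝ) ≤ N := by exact_mod_cast hN
  obtain ⟨h0, hj⟩ := le_sqrt_bohrForm hN hδ x le_rfl
  have hB : 0 ≤ matrixForm (bohrMatrix α N δ) x x := by rw [bohrForm_self]; positivity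
  rw [← Real.le_sqrt (by positivity) hB]
  set r := √(matrixForm (bohrMatrix α N δ) x x) with hr
  have hr0 : 0 ≤ r := Real.sqrt_nonneg _
  by_cases hx0 : x 0 = 0
  · obtain ⟨j, hj0⟩ : ∃ j : Fin d, x j.succ ≠ 0 := by
      by_contra! hall
      exact hx (funext (Fin.cases hx0 hall))
    have h1 := hj j
    rw [hx0, Int.cast_zero, zero_mul, zero_sub, abs_neg] at h1
    have h2 : (1 : ℝ) ≤ |(x j.succ : ℝ)| := by exact_mod_cast Int.one_le_abs hj0
    have h3 : r * δ j ≤ r * 2 := mul_le_mul_of_nonneg_left (hδ2 j) hr0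
    have h4 : (N : ℝ) ^ (-(w / (d + w))) ≤ 1 :=
      Real.rpow_le_one_of_one_le_of_nonpos hN1 (by rw [neg_nonpos]; positivity)
    calc _ ≤ 1 / 2 * (1 : ℝ) :=
          mul_le_mul (min_le_left _ _) h4 (by positivity) (by norm_num)
      _ ≤ r := by linarith
  · set n := (x 0).natAbs with hn
    have hn0 : 0 < n := Int.natAbs_pos.2 hx0
    have hn0' : (0 : ℝ) < n := by exact_mod_cast hn0
    have hnr : (n : ℝ) ≤ r * N := by
      have : (n : ℝ) = |(x 0 : ℝ)| := by rw [hn, Nat.cast_natAbs, Int.cast_abs]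
      rw [this]; exact h0
    have hrpos : 0 < r := pos_of_mul_pos_left (hn0'.trans_le hnr) hN'.le
    have h1 : ∏ i, dn (n * α i) ≤ (2 * r) ^ d := by
      calc _ ≤ ∏ _i : Fin d, (2 * r) := by
            refine Finset.prod_le_prod (fun i _ => abs_nonneg _) fun i _ => ?_
            have := mul_le_mul_of_nonneg_left (hδ2 i) hr0
            linarith [dn_natAbs_mul_le (x 0) (x i.succ) (α i), hj i]
        _ = _ := by simp
    have h2 : (r * N) ^ (-w) ≤ (n : ℝ) ^ (-w) :=
      Real.rpow_le_rpow_of_nonpos hn0' hnr (by linarith)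
    have h3 : c * (r * N) ^ (-w) ≤ 2 ^ d * r ^ d := by
      rw [← mul_pow]
      exact (mul_le_mul_of_nonneg_left h2 hc.le).trans ((hα n hn0).trans h1)
    have h4 : c / 2 ^ d * (N : ℝ) ^ (-w) ≤ r ^ ((d : ℝ) + w) := by
      rw [Real.mul_rpow hr0 hN'.le, Real.rpow_neg hr0] at h3
      rw [Real.rpow_add hrpos, Real.rpow_natCast]
      have hrw : 0 < r ^ w := by positivity
      have h5 := mul_le_mul_of_nonneg_right h3 hrw.le
      rw [div_mul_eq_mul_div, div_le_iff₀ (by positivity)]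
      calc c * (N : ℝ) ^ (-w) = c * ((r ^ w)⁻¹ * (N : ℝ) ^ (-w)) * r ^ w := by field_simp
        _ ≤ _ := h5
        _ = _ := by ring
    have h5 : (c / 2 ^ d * (N : ℝ) ^ (-w)) ^ (1 / ((d : ℝ) + w)) ≤ r := by
      calc _ ≤ (r ^ ((d : ℝ) + w)) ^ (1 / ((d : ℝ) + w)) :=
            Real.rpow_le_rpow (by positivity) h4 (by positivity)
        _ = r := by rw [← Real.rpow_mul hr0, mul_one_div_cancel hdw.ne', Real.rpow_one]
    rw [Real.mul_rpow (by positivity) (by positivity), ← Real.rpow_mul hN'.le] at h5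
    calc _ ≤ (c / 2 ^ d) ^ (1 / ((d : ℝ) + w)) * (N : ℝ) ^ (-w * (1 / ((d : ℝ) + w))) := by
          rw [show -w * (1 / ((d : ℝ) + w)) = -(w / (d + w)) by ring]
          gcongr
          exact min_le_right _ _
      _ ≤ r := h5

end Diophantine

theorem ncard_GAPsym_le {k : ℕ} (A Nl : Fin k → ℕ) :
    (GAPsym A Nl).ncard ≤ ∏ i, (2 * Nl i + 1) := by
  classical
  let box : Finset (Fin k → ℤ) := Fintype.piFinset fun i => Finset.Icc (-(Nl i : ℤ)) (Nl i)
  have hsub : GAPsym A Nl = (fun n : Fin k → ℤ => ∑ i, (A i : ℤ) * n i) '' (box : Set _) := by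
    ext m
    constructor
    · rintro ⟨n, hn, rfl⟩
      exact ⟨n, by simpa [box, abs_le, Pi.le_def, forall_and] using hn, rfl⟩
    · rintro ⟨n, hn, rfl⟩
      exact ⟨n, by simpa [box, abs_le, Pi.le_def, forall_and] using hn, rfl⟩
  rw [hsub]
  refine (Set.ncard_image_le box.finite_toSet).trans (le_of_eq ?_)
  rw [Set.ncard_coe_finset, Fintype.card_piFinset]
  refine Finset.prod_congr rfl fun i _ => ?_
  rw [Int.card_Icc]
  omega

theorem bohrSet_subset_GAPsym {d : ℕ} {α : Fin d → ℝ} {N : ℕ} {δ : Fin d → ℝ} (hN : 0 < N)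
    (hδ : ∀ i, 0 < δ i) {C : ℝ} (hC : 0 < C)
    (b : Module.Basis (Fin (d + 1)) ℤ (Fin (d + 1) → ℤ))
    (hpos : ∀ i, 0 < matrixForm (bohrMatrix α N δ) (b i) (b i))
    (hb : ∀ x i, (b.repr x i : ℝ) ^ 2 * matrixForm (bohrMatrix α N δ) (b i) (b i)
      ≤ C * matrixForm (bohrMatrix α N δ) x x) :
    BohrSet α (fun _ => (0 : ℝ)) N δ ⊆ GAPsym (fun i => (b i 0).natAbs) fun i =>
      ⌊√(C * (d + 1)) / √(matrixForm (bohrMatrix α N δ) (b i) (b i))⌋₊ + 1 := by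
  rintro n ⟨hn, hdn⟩
  have hN' : (0 : ℝ) < N := by exact_mod_cast hN
  let x : Fin (d + 1) → ℤ := Fin.cons n fun i => round ((n : ℝ) * α i)
  have hx : matrixForm (bohrMatrix α N δ) x x ≤ d + 1 := by
    rw [bohrForm_self]
    have h0 : ((x 0 : ℝ) / N) ^ 2 ≤ 1 := by
      rw [sq_le_one_iff_abs_le_one, abs_div, abs_of_pos hN', div_le_one hN']
      have : ((|n| : ℤ) : ℝ) ≤ N := by exact_mod_cast hn
      simpa [x] using this
    have hj : ∀ j ∈ Finset.univ, (((x 0 : ℝ) * α j - x j.succ) / δ j) ^ 2 ≤ 1 := by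
      intro j _
      rw [sq_le_one_iff_abs_le_one, abs_div, abs_of_pos (hδ j), div_le_one (hδ j)]
      simpa [x, dn] using hdn j
    have := Finset.sum_le_card_nsmul _ _ _ hj
    simp only [Finset.card_univ, Fintype.card_fin, nsmul_eq_mul, mul_one] at this
    linarith
  refine ⟨fun i => b.repr x i * (b i 0).sign, fun i => ?_, ?_⟩
  · have hi := hpos i
    set q := matrixForm (bohrMatrix α N δ) (b i) (b i)
    have h1 : (b.repr x i : ℝ) ^ 2 ≤ C * (d + 1) / q := by
      rw [le_div_iff₀ hi]
      exact (hb x i).trans (mul_le_mul_of_nonneg_left hx hC.le)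
    have h2 : |(b.repr x i : ℝ)| ≤ √(C * (d + 1)) / √q := by
      rw [← Real.sqrt_div (by positivity)]
      exact Real.abs_le_sqrt h1
    have h3 : |b.repr x i * (b i 0).sign| ≤ |b.repr x i| := by
      rw [abs_mul]
      refine mul_le_of_le_one_right (abs_nonneg _) ?_
      rcases lt_trichotomy (b i 0) 0 with h | h | h
      · simp [Int.sign_eq_neg_one_of_neg h]
      · simp [h]
      · simp [Int.sign_eq_one_of_pos h]
    refine h3.trans ?_
    have h4 : ((|b.repr x i| : ℤ) : ℝ) < (⌊√(C * (d + 1)) / √q⌋₊ : ℝ) + 1 := by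
      push_cast
      exact h2.trans_lt (Nat.lt_floor_add_one _)
    have h5 : |b.repr x i| < (⌊√(C * (d + 1)) / √q⌋₊ : ℤ) + 1 := by exact_mod_cast h4
    push_cast
    exact h5.le
  · have h1 : n = x 0 := rfl
    rw [h1]
    conv_lhs => rw [← b.sum_repr x]
    rw [Finset.sum_apply]
    refine Finset.sum_congr rfl fun i _ => ?_
    rw [Pi.smul_apply, smul_eq_mul, mul_left_comm, mul_comm ((b i 0).natAbs : ℤ),
      Int.sign_mul_natAbs]

theorem ncard_GAPsym_floor_le {k : ℕ} (A : Fin k → ℕ) {q : Fin k → ℝ} (hq : ∀ i, 0 < q i)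
    (hq1 : ∀ i, q i ≤ 1) {s t : ℝ} (hs : 0 ≤ s) (ht : 0 < t) (hprod : (1 / t) ^ 2 ≤ ∏ i, q i) :
    ((GAPsym A fun i => ⌊s / √(q i)⌋₊ + 1).ncard : ℝ) ≤ (2 * s + 3) ^ k * t := by
  have h1 : ∀ i, ((2 * (⌊s / √(q i)⌋₊ + 1) + 1 : ℕ) : ℝ) ≤ (2 * s + 3) / √(q i) := by
    intro i
    have hqs : 0 < √(q i) := Real.sqrt_pos.2 (hq i)
    have h2 : (⌊s / √(q i)⌋₊ : ℝ) ≤ s / √(q i) := Nat.floor_le (by positivity)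
    have h3 : 1 ≤ 1 / √(q i) := by
      rw [le_div_iff₀ hqs, one_mul]
      exact Real.sqrt_le_one.2 (hq1 i)
    push_cast
    calc _ ≤ 2 * (s / √(q i)) + 3 * (1 / √(q i)) := by linarith
      _ = _ := by ring
  have h4 : 1 / t ≤ ∏ i, √(q i) := by
    rw [← Real.sqrt_prod _ fun i _ => (hq i).le]
    exact Real.le_sqrt_of_sq_le hprod
  calc _ ≤ ((∏ i, (2 * (⌊s / √(q i)⌋₊ + 1) + 1) : ℕ) : ℝ) := by
        exact_mod_cast ncard_GAPsym_le A _
    _ ≤ ∏ i, (2 * s + 3) / √(q i) := by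
        rw [Nat.cast_prod]
        exact Finset.prod_le_prod (fun i _ => by positivity) fun i _ => h1 i
    _ = (2 * s + 3) ^ k / ∏ i, √(q i) := by simp [Finset.prod_div_distrib]
    _ ≤ (2 * s + 3) ^ k / (1 / t) := by gcongr
    _ = _ := by rw [div_div_eq_mul_div, div_one]

theorem bohr_outer_structure_succ {d : ℕ} (hd : 1 ≤ d) (α : Fin d → ℝ)
    (hα : multExp α < mBound (d + 1)) :
    ∃ ε0 : ℝ, 0 < ε0 ∧ ∀ ε : ℝ, 0 < ε → ε ≤ ε0 →
      ∃ C : ℝ, 0 < C ∧ ∃ N0 : ℕ, ∀ N : ℕ, N0 ≤ N →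
        ∀ δ : Fin d → ℝ,
          (∀ i, (N : ℝ) ^ (-(Real.sqrt ε)) ≤ δ i ∧ δ i ≤ 2) →
          ∃ A Nl : Fin (d + 1) → ℕ, (∀ i, 0 < A i) ∧ (∀ i, 0 < Nl i) ∧
            BohrSet α (fun _ => (0 : ℝ)) N δ ⊆ GAPsym A Nl ∧
            ((GAPsym A Nl).ncard : ℝ) ≤ C * ((∏ i, δ i) * N) := by
  obtain ⟨w, hw, hαw, hdw⟩ := exists_exponent_btwn hd hα
  obtain ⟨c₀, hc₀, hlow⟩ := exists_prod_dn_lower_bound hαw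
  obtain ⟨c, hc, hmin⟩ := bohrForm_lower_bound hw hc₀ hlow
  obtain ⟨C, hC, hred⟩ := exists_reduced_basis (d + 1)
  have hd0 : (0 : ℝ) < d := by exact_mod_cast hd
  set σ := w / (d + w) with hσ
  set θ := 1 - d * σ with hθ
  have hθ0 : 0 < θ := by
    have : d * σ < 1 := by
      rw [hσ, ← mul_div_assoc, div_lt_one (by positivity)]
      exact hdw
    linarith
  refine ⟨(θ / (2 * d)) ^ 2, by positivity, fun ε _ hε => ?_⟩
  set τ := √ε with hτ
  have hτθ : d * τ ≤ θ / 2 := by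
    have h1 : τ ≤ θ / (2 * d) := Real.sqrt_le_iff.2 ⟨by positivity, hε⟩
    calc d * τ ≤ d * (θ / (2 * d)) := by gcongr
      _ = θ / 2 := by field_simp
  refine ⟨(2 * √(C * (d + 1)) + 3) ^ (d + 1), by positivity, ?_⟩
  have hlim : Tendsto (fun N : ℕ => C / c ^ (2 * d) * (N : ℝ) ^ (-θ)) atTop (nhds 0) := by
    have := ((tendsto_rpow_neg_atTop hθ0).comp tendsto_natCast_atTop_atTop).const_mul
      (C / c ^ (2 * d))
    simpa using this
  obtain ⟨N0, hN0⟩ := eventually_atTop.1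
    ((hlim.eventually_lt_const (by norm_num : (0 : ℝ) < 1 / 16)).and (eventually_ge_atTop 1))
  refine ⟨N0, fun N hNN δ hδ => ?_⟩
  obtain ⟨hsmall, hN⟩ := hN0 N hNN
  have hN' : (0 : ℝ) < N := by exact_mod_cast hN
  have hN1 : (1 : ℝ) ≤ N := by exact_mod_cast hN
  have hδ0 : ∀ i, 0 < δ i := fun i => (Real.rpow_pos_of_pos hN' _).trans_le (hδ i).1
  have hδ2 : ∀ i, δ i ≤ 2 := fun i => (hδ i).2
  have hδp : 0 < ∏ i, δ i := Finset.prod_pos fun i _ => hδ0 i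
  obtain ⟨b, hb1, hb2, hb3⟩ := hred (Fin (d + 1) → ℤ) (by simp)
    (matrixForm (bohrMatrix α N δ)) (matrixForm_comm _) (bohrForm_finite hN hδ0)
  rw [det_gram_matrixForm, bohrMatrix_det_sq] at hb1 hb2
  set q : Fin (d + 1) → ℝ := fun i => matrixForm (bohrMatrix α N δ) (b i) (b i) with hq
  set ρ := c * (N : ℝ) ^ (-σ) with hρ
  have hρ0 : 0 < ρ := by positivity
  have hρq : ∀ i, ρ ^ 2 ≤ q i := fun i => hmin N hN δ hδ0 hδ2 _ (b.ne_zero i)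
  have hq0 : ∀ i, 0 < q i := fun i => (by positivity : 0 < ρ ^ 2).trans_le (hρq i)
  have hprodδ : (N : ℝ) ^ (-(d * τ)) ≤ ∏ i, δ i := by
    calc _ = ∏ _i : Fin d, (N : ℝ) ^ (-τ) := by
          rw [Finset.prod_const, Finset.card_univ, Fintype.card_fin, ← Real.rpow_natCast,
            ← Real.rpow_mul hN'.le]
          congr 1
          ring
      _ ≤ _ := Finset.prod_le_prod (fun i _ => by positivity) fun i _ => (hδ i).1
  have hqlt : ∀ i, q i < 1 / 16 := by
    intro i
    have h1 : q i * (ρ ^ 2) ^ d ≤ ∏ j, q j := by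
      rw [Fin.prod_univ_succAbove _ i]
      refine mul_le_mul_of_nonneg_left ?_ (hq0 i).le
      calc _ = ∏ _j : Fin d, ρ ^ 2 := by simp
        _ ≤ _ := Finset.prod_le_prod (fun _ _ => by positivity) fun j _ => hρq _
    have h2 : 1 / ((∏ i, δ i) * N) ≤ (N : ℝ) ^ (d * τ - 1) := by
      calc _ ≤ 1 / ((N : ℝ) ^ (-(d * τ)) * N) := by gcongr
        _ = _ := by
          rw [Real.rpow_neg hN'.le, Real.rpow_sub hN', Real.rpow_one]
          field_simp
    have h3 : q i * (ρ ^ 2) ^ d ≤ C * ((N : ℝ) ^ (d * τ - 1)) ^ 2 :=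
      (h1.trans hb2).trans (by gcongr)
    have h4 : (ρ ^ 2) ^ d = c ^ (2 * d) * (N : ℝ) ^ (-(2 * (d * σ))) := by
      rw [← pow_mul, hρ, mul_pow, ← Real.rpow_natCast ((N : ℝ) ^ (-σ)), ← Real.rpow_mul hN'.le]
      congr 2
      push_cast
      ring
    have h5 : ((N : ℝ) ^ (d * τ - 1)) ^ 2
        = (N : ℝ) ^ (2 * (d * τ) - 2 * θ) * (N : ℝ) ^ (-(2 * (d * σ))) := by
      rw [← Real.rpow_natCast, ← Real.rpow_mul hN'.le, ← Real.rpow_add hN']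
      congr 1
      rw [hθ]
      push_cast
      ring
    have h6 : q i * c ^ (2 * d) ≤ C * (N : ℝ) ^ (2 * (d * τ) - 2 * θ) := by
      rw [h4, h5] at h3
      have h7 : 0 < (N : ℝ) ^ (-(2 * (d * σ))) := by positivity
      refine le_of_mul_le_mul_right ?_ h7
      linarith
    refine lt_of_le_of_lt ?_ hsmall
    rw [div_mul_eq_mul_div, le_div_iff₀ (by positivity)]
    refine h6.trans (mul_le_mul_of_nonneg_left ?_ hC.le)
    exact Real.rpow_le_rpow_of_exponent_le hN1 (by linarith)
  refine ⟨_, _, fun i => ?_, fun i => Nat.succ_pos _,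
    bohrSet_subset_GAPsym hN hδ0 hC b hq0 hb3, ?_⟩
  · refine Int.natAbs_pos.2 fun h0 => (b.ne_zero i) (funext (Fin.cases h0 fun j => ?_))
    have h1 := (le_sqrt_bohrForm hN hδ0 (b i) (hqlt i).le).2 j
    have h2 : √(1 / 16 : ℝ) = 1 / 4 := by
      rw [show (1 / 16 : ℝ) = (1 / 4) ^ 2 by norm_num, Real.sqrt_sq (by norm_num)]
    by_contra h3
    have h4 : (1 : ℝ) ≤ |(b i j.succ : ℝ)| := by exact_mod_cast Int.one_le_abs h3
    have h5 : |(b i j.succ : ℝ)| < 1 := by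
      rw [h0, h2, Int.cast_zero, zero_mul, zero_sub, abs_neg] at h1
      linarith [hδ2 j]
    linarith
  · exact ncard_GAPsym_floor_le _ hq0 (fun i => by linarith [hqlt i]) (Real.sqrt_nonneg _)
      (by positivity) hb1

/-- Outer structure: under `ω^×(α) < (k-1)/(k-2)` (read `< ∞` for `k = 2`), for small `ε`
with `τ = √ε`, large `N` and `N^{-τ} ≤ δ_i ≤ 2`, the homogeneous Bohr set `B_α^0(N; δ)`
is contained in some GAP `P(0; A; N₁,…,N_k)` of cardinality `≤ C δ₁⋯δ_{k-1} N`. -/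
theorem bohr_outer_structure (k : ℕ) (hk : 2 ≤ k) (α : Fin (k - 1) → ℝ)
    (hα : multExp α < mBound k) :
    ∃ ε0 : ℝ, 0 < ε0 ∧ ∀ ε : ℝ, 0 < ε → ε ≤ ε0 →
      ∃ C : ℝ, 0 < C ∧ ∃ N0 : ℕ, ∀ N : ℕ, N0 ≤ N →
        ∀ δ : Fin (k - 1) → ℝ,
          (∀ i, (N : ℝ) ^ (-(Real.sqrt ε)) ≤ δ i ∧ δ i ≤ 2) →
          ∃ A Nl : Fin k → ℕ, (∀ i, 0 < A i) ∧ (∀ i, 0 < Nl i) ∧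
            BohrSet α (fun _ => (0 : ℝ)) N δ ⊆ GAPsym A Nl ∧
            ((GAPsym A Nl).ncard : ℝ) ≤ C * ((∏ i, δ i) * N) := by
  obtain ⟨d, rfl⟩ : ∃ d, k = d + 1 := ⟨k - 1, by omega⟩
  exact bohr_outer_structure_succ (by omega) α hα
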